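/- For all 1 ≤ r ≤ N−1, 1 ≤ s ≤ N−1 and all i, j ∈ {1,2,3,4}, ‖[[D_r, T_r^(i)], T_s^(j)]‖ ≤ x²·(μ/2 + Λ + 1/2). -/

import Mathlib

open Matrix Complex

noncomputable section

/-- The spectral (ℓ²-operator) norm of a complex square matrix. -/
def specNorm {n : Type*} [Fintype n] [DecidableEq n] (M : Matrix n n ℂ) : ℝ :=
  ‖Matrix.toEuclideanCLM (𝕜 := ℂ) M‖

/-- Pauli X. -/
def PX : Matrix (Fin 2) (Fin 2) ℂ := !![0, 1; 1, 0]
/-- Pauli Y. -/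
def PY : Matrix (Fin 2) (Fin 2) ℂ := !![0, -I; I, 0]
/-- Pauli Z. -/
def PZ : Matrix (Fin 2) (Fin 2) ℂ := !![1, 0; 0, -1]

/-- Electric field operator `E |j⟩ = (j - Λ)|j⟩` on `ℂ^(2^η)`, `Λ = 2^(η-1)`. -/
def Eop (η : ℕ) : Matrix (Fin (2 ^ η)) (Fin (2 ^ η)) ℂ :=
  Matrix.diagonal fun j => ((j : ℕ) : ℂ) - ((2 ^ (η - 1) : ℕ) : ℂ)

/-- Link operator `U |j⟩ = |j + 1 mod 2^η⟩`. -/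
def Uop (η : ℕ) : Matrix (Fin (2 ^ η)) (Fin (2 ^ η)) ℂ :=
  Matrix.of fun j k => if (j : ℕ) = ((k : ℕ) + 1) % 2 ^ η then 1 else 0

/-- `A |j⟩ = |j XOR 1⟩`. -/
def Aop (η : ℕ) : Matrix (Fin (2 ^ η)) (Fin (2 ^ η)) ℂ :=
  Matrix.of fun j k => if (j : ℕ) = (k : ℕ) ^^^ 1 then 1 else 0

/-- `B |j⟩ = i (-1)^j |j XOR 1⟩`. -/
def Bop (η : ℕ) : Matrix (Fin (2 ^ η)) (Fin (2 ^ η)) ℂ :=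
  Matrix.of fun j k => if (j : ℕ) = (k : ℕ) ^^^ 1 then I * (-1) ^ (k : ℕ) else 0

/-- Configurations of the lattice: a qubit for each of the `N` sites (0-indexed; the paper's
site `r` is index `r - 1`) and a `2^η`-dimensional register for each of the `N - 1` links
(0-indexed; the paper's link `r` is index `r - 1`). -/
abbrev Config (N η : ℕ) := (Fin N → Fin 2) × (Fin (N - 1) → Fin (2 ^ η))

/-- Operators on the lattice Hilbert space `(ℂ²)^{⊗N} ⊗ (ℂ^{2Λ})^{⊗(N-1)}`. -/
abbrev LatOp (N η : ℕ) := Matrix (Config N η) (Config N η) ℂ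

/-- A single-qubit operator `M` acting on the `r`-th site factor. -/
def siteOp (N η : ℕ) (r : Fin N) (M : Matrix (Fin 2) (Fin 2) ℂ) : LatOp N η :=
  Matrix.of fun p q =>
    if p.2 = q.2 ∧ ∀ s, s ≠ r → p.1 s = q.1 s then M (p.1 r) (q.1 r) else 0

/-- A single-link operator `M` acting on the `r`-th link factor. -/
def linkOp (N η : ℕ) (r : Fin (N - 1)) (M : Matrix (Fin (2 ^ η)) (Fin (2 ^ η)) ℂ) :
    LatOp N η :=
  Matrix.of fun p q =>
    if p.1 = q.1 ∧ ∀ s, s ≠ r → p.2 s = q.2 s then M (p.2 r) (q.2 r) else 0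

/-- For the `r`-th link (0-indexed), the site on its left, as an index into `Fin N`. -/
def siteL {N : ℕ} (r : Fin (N - 1)) : Fin N := ⟨r.1, by have := r.2; omega⟩

/-- For the `r`-th link (0-indexed), the site on its right, as an index into `Fin N`. -/
def siteR {N : ℕ} (r : Fin (N - 1)) : Fin N := ⟨r.1 + 1, by have := r.2; omega⟩

/-- `X_r X_{r+1} + Y_r Y_{r+1}` (paper indices; `r` is the 0-indexed link). -/
def Gop (N η : ℕ) (r : Fin (N - 1)) : LatOp N η :=
  siteOp N η (siteL r) PX * siteOp N η (siteR r) PX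
    + siteOp N η (siteL r) PY * siteOp N η (siteR r) PY

/-- `X_r Y_{r+1} - Y_r X_{r+1}` (paper indices; `r` is the 0-indexed link). -/
def Gtilde (N η : ℕ) (r : Fin (N - 1)) : LatOp N η :=
  siteOp N η (siteL r) PX * siteOp N η (siteR r) PY
    - siteOp N η (siteL r) PY * siteOp N η (siteR r) PX

/-- The four hopping terms `T_r^(1), …, T_r^(4)` (`j = 0,…,3` is the paper's `j = 1,…,4`;
`r` is the 0-indexed link, the paper's site/link `r+1`). -/
def Thop (N η : ℕ) (x : ℝ) (r : Fin (N - 1)) : Fin 4 → LatOp N η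
  | 0 => ((x : ℂ) / 4) • (linkOp N η r (Aop η) * Gop N η r)
  | 1 => ((x : ℂ) / 4) • (linkOp N η r ((Uop η)ᴴ * Aop η * Uop η) * Gop N η r)
  | 2 => ((x : ℂ) / 4) • (linkOp N η r ((Uop η)ᴴ * Bop η * Uop η) * Gtilde N η r)
  | 3 => ((x : ℂ) / 4) • (linkOp N η r (Bop η) * Gtilde N η r)

/-- Mass term `D_r^(M) = -(μ/2) (-1)^r Z_r` at the 0-indexed site `i` (paper's site `r = i+1`). -/
def DM (N η : ℕ) (μ : ℝ) (i : Fin N) : LatOp N η :=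
  ((-(μ : ℂ) / 2) * (-1) ^ ((i : ℕ) + 1)) • siteOp N η i PZ

/-- Electric term `D_r^(E) = E_r²` at the 0-indexed link `r`. -/
def DE (N η : ℕ) (r : Fin (N - 1)) : LatOp N η := (linkOp N η r (Eop η)) ^ 2

/-- `D_r = D_r^(M) + D_r^(E)` for the paper's `1 ≤ r ≤ N - 1` (`r` the 0-indexed link). -/
def Dlink (N η : ℕ) (μ : ℝ) (r : Fin (N - 1)) : LatOp N η :=
  DM N η μ (siteL r) + DE N η r

end

section

open scoped Matrix.Norms.L2Operator

/-- A matrix with at most one nonzero entry in each row and column, all entries being bounded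
by `C` in norm. -/
structure MonomialLE {n : Type*} (C : ℝ) (M : Matrix n n ℂ) : Prop where
  row : ∀ a j k, M a j ≠ 0 → M a k ≠ 0 → j = k
  col : ∀ a b j, M a j ≠ 0 → M b j ≠ 0 → a = b
  le : ∀ a j, ‖M a j‖ ≤ C

theorem specNorm_eq_norm {n : Type*} [Fintype n] [DecidableEq n] (M : Matrix n n ℂ) :
    specNorm M = ‖M‖ := rfl

theorem MonomialLE.norm_le {n : Type*} [Fintype n] [DecidableEq n] {C : ℝ} (hC : 0 ≤ C)
    {M : Matrix n n ℂ} (h : MonomialLE C M) : ‖M‖ ≤ C := by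
  have hdiag : Mᴴ * M = diagonal fun j => ∑ a, star (M a j) * M a j := by
    ext j k
    rw [mul_apply, diagonal_apply]
    split_ifs with hjk
    · subst hjk
      rfl
    · refine Finset.sum_eq_zero fun a _ => ?_
      by_contra hne
      exact hjk (h.row a j k (star_ne_zero.mp (left_ne_zero_of_mul hne))
        (right_ne_zero_of_mul hne))
  have hsq : ‖M‖ * ‖M‖ ≤ C * C := by
    rw [← l2_opNorm_conjTranspose_mul_self, hdiag, l2_opNorm_diagonal,
      pi_norm_le_iff_of_nonneg (by positivity)]
    intro j
    by_cases hz : ∃ a, M a j ≠ 0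
    · obtain ⟨a, ha⟩ := hz
      rw [Finset.sum_eq_single a, norm_mul, norm_star]
      · exact mul_le_mul (h.le a j) (h.le a j) (norm_nonneg _) hC
      · intro b _ hb
        by_contra hne
        exact hb (h.col b a j (right_ne_zero_of_mul hne) ha)
      · simp
    · push Not at hz
      simp only [hz, mul_zero, Finset.sum_const_zero, norm_zero]
      positivity
  exact abs_le_of_sq_le_sq' (by nlinarith) hC |>.2

theorem monomialLE_siteOp (N η : ℕ) (r : Fin N) {C : ℝ} (hC : 0 ≤ C)
    {M : Matrix (Fin 2) (Fin 2) ℂ} (h : MonomialLE C M) : MonomialLE C (siteOp N η r M) where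
  row a j k hj hk := by
    simp only [siteOp, of_apply, ne_eq, ite_eq_right_iff, Classical.not_imp] at hj hk
    refine Prod.ext (funext fun t => ?_) (hj.1.1.symm.trans hk.1.1)
    by_cases ht : t = r
    · subst ht
      exact h.row _ _ _ hj.2 hk.2
    · exact (hj.1.2 t ht).symm.trans (hk.1.2 t ht)
  col a b j ha hb := by
    simp only [siteOp, of_apply, ne_eq, ite_eq_right_iff, Classical.not_imp] at ha hb
    refine Prod.ext (funext fun t => ?_) (ha.1.1.trans hb.1.1.symm)
    by_cases ht : t = r
    · subst ht
      exact h.col _ _ _ ha.2 hb.2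
    · exact (ha.1.2 t ht).trans (hb.1.2 t ht).symm
  le a j := by
    simp only [siteOp, of_apply]
    split_ifs
    · exact h.le _ _
    · simpa using hC

theorem monomialLE_linkOp (N η : ℕ) (r : Fin (N - 1)) {C : ℝ} (hC : 0 ≤ C)
    {M : Matrix (Fin (2 ^ η)) (Fin (2 ^ η)) ℂ} (h : MonomialLE C M) :
    MonomialLE C (linkOp N η r M) where
  row a j k hj hk := by
    simp only [linkOp, of_apply, ne_eq, ite_eq_right_iff, Classical.not_imp] at hj hk
    refine Prod.ext (hj.1.1.symm.trans hk.1.1) (funext fun t => ?_)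
    by_cases ht : t = r
    · subst ht
      exact h.row _ _ _ hj.2 hk.2
    · exact (hj.1.2 t ht).symm.trans (hk.1.2 t ht)
  col a b j ha hb := by
    simp only [linkOp, of_apply, ne_eq, ite_eq_right_iff, Classical.not_imp] at ha hb
    refine Prod.ext (ha.1.1.trans hb.1.1.symm) (funext fun t => ?_)
    by_cases ht : t = r
    · subst ht
      exact h.col _ _ _ ha.2 hb.2
    · exact (ha.1.2 t ht).trans (hb.1.2 t ht).symm
  le a j := by
    simp only [linkOp, of_apply]
    split_ifs
    · exact h.le _ _
    · simpa using hC

theorem monomialLE_PX : MonomialLE 1 PX := by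
  constructor <;> simp [PX, Fin.forall_fin_two]

theorem monomialLE_PY : MonomialLE 1 PY := by
  constructor <;> simp [PY, Fin.forall_fin_two]

theorem monomialLE_PZ : MonomialLE 1 PZ := by
  constructor <;> simp [PZ, Fin.forall_fin_two]

theorem norm_siteOp_le_one (N η : ℕ) (r : Fin N) {M : Matrix (Fin 2) (Fin 2) ℂ}
    (h : MonomialLE 1 M) : ‖siteOp N η r M‖ ≤ 1 :=
  (monomialLE_siteOp N η r zero_le_one h).norm_le zero_le_one

theorem norm_siteOp_mul_le_one (N η : ℕ) (r s : Fin N) {M M' : Matrix (Fin 2) (Fin 2) ℂ}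
    (h : MonomialLE 1 M) (h' : MonomialLE 1 M') : ‖siteOp N η r M * siteOp N η s M'‖ ≤ 1 :=
  (norm_mul_le _ _).trans <|
    mul_le_one₀ (norm_siteOp_le_one N η r h) (norm_nonneg _) (norm_siteOp_le_one N η s h')

theorem norm_Gop_le (N η : ℕ) (r : Fin (N - 1)) : ‖Gop N η r‖ ≤ 2 := by
  have hX := norm_siteOp_mul_le_one N η (siteL r) (siteR r) monomialLE_PX monomialLE_PX
  have hY := norm_siteOp_mul_le_one N η (siteL r) (siteR r) monomialLE_PY monomialLE_PY
  exact (norm_add_le _ _).trans (by linarith)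

theorem norm_Gtilde_le (N η : ℕ) (r : Fin (N - 1)) : ‖Gtilde N η r‖ ≤ 2 := by
  have hX := norm_siteOp_mul_le_one N η (siteL r) (siteR r) monomialLE_PX monomialLE_PY
  have hY := norm_siteOp_mul_le_one N η (siteL r) (siteR r) monomialLE_PY monomialLE_PX
  exact (norm_sub_le _ _).trans (by linarith)

theorem norm_DM_le (N η : ℕ) {μ : ℝ} (hμ : 0 ≤ μ) (i : Fin N) : ‖DM N η μ i‖ ≤ μ / 2 := by
  have h := norm_siteOp_le_one N η i monomialLE_PZ
  rw [DM, norm_smul]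
  have hc : ‖(-(μ : ℂ) / 2) * (-1) ^ ((i : ℕ) + 1)‖ = μ / 2 := by
    simp [abs_of_nonneg hμ]
  rw [hc]
  exact mul_le_of_le_one_right (by positivity) h

/-- The eigenvalue of `E²` on the basis state `|j⟩`. -/
def electricEnergy (η : ℕ) (j : Fin (2 ^ η)) : ℂ :=
  (((j : ℕ) : ℂ) - ((2 ^ (η - 1) : ℕ) : ℂ)) ^ 2

theorem DE_eq_diagonal (N η : ℕ) (r : Fin (N - 1)) :
    DE N η r = diagonal fun p => electricEnergy η (p.2 r) := by
  have h : linkOp N η r (Eop η) =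
      diagonal fun p => ((p.2 r : ℕ) : ℂ) - ((2 ^ (η - 1) : ℕ) : ℂ) := by
    ext p q
    rw [diagonal_apply]
    simp only [linkOp, Eop, of_apply, diagonal_apply]
    by_cases hpq : p = q
    · subst hpq
      simp
    · rw [if_neg hpq, ite_eq_right_iff]
      rintro ⟨h1, h2⟩
      rw [if_neg]
      intro hr
      refine hpq (Prod.ext h1 (funext fun t => ?_))
      by_cases ht : t = r
      · rw [ht, hr]
      · exact h2 t ht
  rw [DE, h, diagonal_pow]
  rfl

theorem commute_DE_siteOp (N η : ℕ) (r : Fin (N - 1)) (s : Fin N)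
    (M : Matrix (Fin 2) (Fin 2) ℂ) : Commute (DE N η r) (siteOp N η s M) := by
  rw [DE_eq_diagonal]
  ext p q
  rw [diagonal_mul, mul_diagonal]
  simp only [siteOp, of_apply]
  split_ifs with h
  · rw [h.1, mul_comm]
  · simp

theorem commute_DE_Gop (N η : ℕ) (r s : Fin (N - 1)) : Commute (DE N η r) (Gop N η s) :=
  ((commute_DE_siteOp ..).mul_right (commute_DE_siteOp ..)).add_right
    ((commute_DE_siteOp ..).mul_right (commute_DE_siteOp ..))

theorem commute_DE_Gtilde (N η : ℕ) (r s : Fin (N - 1)) :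
    Commute (DE N η r) (Gtilde N η s) :=
  ((commute_DE_siteOp ..).mul_right (commute_DE_siteOp ..)).sub_right
    ((commute_DE_siteOp ..).mul_right (commute_DE_siteOp ..))

theorem DE_commutator_linkOp (N η : ℕ) (r : Fin (N - 1))
    (M : Matrix (Fin (2 ^ η)) (Fin (2 ^ η)) ℂ) :
    DE N η r * linkOp N η r M - linkOp N η r M * DE N η r =
      linkOp N η r (of fun j k => (electricEnergy η j - electricEnergy η k) * M j k) := by
  rw [DE_eq_diagonal]
  ext p q
  rw [Matrix.sub_apply, diagonal_mul, mul_diagonal]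
  simp only [linkOp, of_apply]
  split_ifs
  · ring
  · simp

/-- A link operator that hops between basis states whose electric energies differ by at most
`2 Λ`, with amplitudes of norm at most one. -/
structure IsHop (η : ℕ) (M : Matrix (Fin (2 ^ η)) (Fin (2 ^ η)) ℂ) : Prop where
  monomial : MonomialLE 1 M
  energy : ∀ j k, M j k ≠ 0 → ‖electricEnergy η j - electricEnergy η k‖ ≤ 2 * (2 ^ (η - 1) : ℕ)

theorem IsHop.monomialLE_commutator {η : ℕ} {M : Matrix (Fin (2 ^ η)) (Fin (2 ^ η)) ℂ}
    (h : IsHop η M) : MonomialLE (2 * (2 ^ (η - 1) : ℕ))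
      (of fun j k => (electricEnergy η j - electricEnergy η k) * M j k) where
  row a j k hj hk := h.monomial.row a j k (right_ne_zero_of_mul hj) (right_ne_zero_of_mul hk)
  col a b j ha hb := h.monomial.col a b j (right_ne_zero_of_mul ha) (right_ne_zero_of_mul hb)
  le a j := by
    rw [of_apply, norm_mul]
    by_cases hM : M a j = 0
    · rw [hM]
      simp
    · exact (mul_le_mul (h.energy a j hM) (h.monomial.le a j) (norm_nonneg _)
        (by positivity)).trans_eq (mul_one _)

theorem norm_electricEnergy_sub_le {η : ℕ} (hη : 1 ≤ η) (j k : Fin (2 ^ η))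
    (h : (j : ℕ) = k + 1 ∨ (k : ℕ) = j + 1 ∨ (j : ℕ) + k + 1 = 2 ^ η) :
    ‖electricEnergy η j - electricEnergy η k‖ ≤ 2 * (2 ^ (η - 1) : ℕ) := by
  have hΛ : 2 ^ η = 2 * 2 ^ (η - 1) := by
    rw [← pow_succ', Nat.sub_add_cancel hη]
  have hj := j.2
  have hk := k.2
  simp only [electricEnergy]
  generalize (j : ℕ) = a at *
  generalize (k : ℕ) = b at *
  generalize 2 ^ (η - 1) = L at *
  rw [hΛ] at hj hk h
  have hreal : (((a : ℂ) - (L : ℂ)) ^ 2 - ((b : ℂ) - (L : ℂ)) ^ 2) =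
      ((((a : ℝ) - L) ^ 2 - ((b : ℝ) - L) ^ 2 : ℝ) : ℂ) := by push_cast; rfl
  rw [hreal, Complex.norm_real, Real.norm_eq_abs, abs_le]
  have hj' : (a : ℝ) + 1 ≤ 2 * L := by exact_mod_cast hj
  have hk' : (b : ℝ) + 1 ≤ 2 * L := by exact_mod_cast hk
  have ha0 : (0 : ℝ) ≤ a := a.cast_nonneg
  have hb0 : (0 : ℝ) ≤ b := b.cast_nonneg
  rcases h with h | h | h
  · have h' : (a : ℝ) = b + 1 := by exact_mod_cast h
    rw [h'] at *
    constructor <;> nlinarith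
  · have h' : (b : ℝ) = a + 1 := by exact_mod_cast h
    rw [h'] at *
    constructor <;> nlinarith
  · have h' : (a : ℝ) = 2 * L - 1 - b := by
      have : (a : ℝ) + b + 1 = 2 * L := by exact_mod_cast h
      linarith
    rw [h'] at *
    constructor <;> nlinarith

theorem xor_one_eq_iff {a b : ℕ} (h : a = b ^^^ 1) :
    (a = b + 1 ∧ b % 2 = 0) ∨ (b = a + 1 ∧ a % 2 = 0) := by
  rcases Nat.even_or_odd b with hb | hb
  · rw [Nat.xor_one_of_even hb] at h
    exact Or.inl ⟨h, Nat.even_iff.mp hb⟩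
  · rw [Nat.xor_one_of_odd hb] at h
    rw [Nat.odd_iff] at hb
    omega

/-- The cyclic shift `j ↦ j + 1 mod 2^η`. -/
def cyclicShift (η : ℕ) (j : Fin (2 ^ η)) : Fin (2 ^ η) :=
  ⟨((j : ℕ) + 1) % 2 ^ η, Nat.mod_lt _ (by positivity)⟩

theorem cyclicShift_val (η : ℕ) (j : Fin (2 ^ η)) :
    ((j : ℕ) + 1 < 2 ^ η ∧ (cyclicShift η j : ℕ) = j + 1) ∨
      ((j : ℕ) + 1 = 2 ^ η ∧ (cyclicShift η j : ℕ) = 0) := by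
  have hj := j.2
  simp only [cyclicShift]
  rcases Nat.lt_or_ge ((j : ℕ) + 1) (2 ^ η) with h | h
  · exact Or.inl ⟨h, Nat.mod_eq_of_lt h⟩
  · have h' : (j : ℕ) + 1 = 2 ^ η := by omega
    exact Or.inr ⟨h', by rw [h', Nat.mod_self]⟩

theorem cyclicShift_injective (η : ℕ) : Function.Injective (cyclicShift η) := by
  intro j k h
  have hv := congrArg Fin.val h
  ext
  rcases cyclicShift_val η j with hj | hj <;> rcases cyclicShift_val η k with hk | hk <;> omega

theorem Uop_conj (η : ℕ) (M : Matrix (Fin (2 ^ η)) (Fin (2 ^ η)) ℂ) :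
    (Uop η)ᴴ * M * Uop η = M.submatrix (cyclicShift η) (cyclicShift η) := by
  have hU : ∀ j k, Uop η j k = if j = cyclicShift η k then 1 else 0 := by
    intro j k
    simp only [Uop, of_apply, cyclicShift, Fin.ext_iff]
  ext j k
  simp [mul_apply, hU, apply_ite]

/-- A matrix supported on the pairs `j = k XOR 1`, with entries of norm at most one. -/
structure IsXorFlip (η : ℕ) (M : Matrix (Fin (2 ^ η)) (Fin (2 ^ η)) ℂ) : Prop where
  support : ∀ j k, M j k ≠ 0 → (j : ℕ) = (k : ℕ) ^^^ 1
  le : ∀ j k, ‖M j k‖ ≤ 1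

theorem isXorFlip_Aop (η : ℕ) : IsXorFlip η (Aop η) where
  support j k h := by
    by_contra hne
    exact h (if_neg hne)
  le j k := by
    simp only [Aop, of_apply]
    split_ifs <;> simp

theorem isXorFlip_Bop (η : ℕ) : IsXorFlip η (Bop η) where
  support j k h := by
    by_contra hne
    exact h (if_neg hne)
  le j k := by
    simp only [Bop, of_apply]
    split_ifs <;> simp

theorem IsXorFlip.monomialLE {η : ℕ} {M : Matrix (Fin (2 ^ η)) (Fin (2 ^ η)) ℂ}
    (h : IsXorFlip η M) : MonomialLE 1 M where
  row a j k hj hk := Fin.ext <| Nat.xor_left_injective <|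
    (h.support a j hj).symm.trans (h.support a k hk)
  col a b j ha hb := Fin.ext <| (h.support a j ha).trans (h.support b j hb).symm
  le := h.le

theorem IsXorFlip.isHop {η : ℕ} (hη : 1 ≤ η) {M : Matrix (Fin (2 ^ η)) (Fin (2 ^ η)) ℂ}
    (h : IsXorFlip η M) : IsHop η M where
  monomial := h.monomialLE
  energy j k hjk := norm_electricEnergy_sub_le hη j k <| by
    have := xor_one_eq_iff (h.support j k hjk)
    omega

theorem IsXorFlip.isHop_conj {η : ℕ} (hη : 1 ≤ η) {M : Matrix (Fin (2 ^ η)) (Fin (2 ^ η)) ℂ}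
    (h : IsXorFlip η M) : IsHop η ((Uop η)ᴴ * M * Uop η) := by
  rw [Uop_conj]
  refine ⟨⟨fun a j k hj hk => cyclicShift_injective η (h.monomialLE.row _ _ _ hj hk),
    fun a b j ha hb => cyclicShift_injective η (h.monomialLE.col _ _ _ ha hb),
    fun a j => h.le _ _⟩, fun j k hjk => norm_electricEnergy_sub_le hη j k ?_⟩
  have hx := xor_one_eq_iff (h.support _ _ hjk)
  rcases cyclicShift_val η j with hj | hj <;> rcases cyclicShift_val η k with hk | hk <;> omega

theorem exists_Thop_eq {N η : ℕ} (hη : 1 ≤ η) (x : ℝ) (r : Fin (N - 1)) (i : Fin 4) :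
    ∃ M G, IsHop η M ∧ ‖G‖ ≤ 2 ∧ Commute (DE N η r) G ∧
      Thop N η x r i = ((x : ℂ) / 4) • (linkOp N η r M * G) := by
  fin_cases i
  · exact ⟨_, _, (isXorFlip_Aop η).isHop hη, norm_Gop_le N η r, commute_DE_Gop N η r r, rfl⟩
  · exact ⟨_, _, (isXorFlip_Aop η).isHop_conj hη, norm_Gop_le N η r, commute_DE_Gop N η r r, rfl⟩
  · exact ⟨_, _, (isXorFlip_Bop η).isHop_conj hη, norm_Gtilde_le N η r,
      commute_DE_Gtilde N η r r, rfl⟩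
  · exact ⟨_, _, (isXorFlip_Bop η).isHop hη, norm_Gtilde_le N η r,
      commute_DE_Gtilde N η r r, rfl⟩

theorem norm_hopping_coeff {x : ℝ} (hx : 0 < x) : ‖(x : ℂ) / 4‖ = x / 4 := by
  simp [abs_of_pos hx]

theorem norm_Thop_le {N η : ℕ} (hη : 1 ≤ η) {x : ℝ} (hx : 0 < x) (r : Fin (N - 1))
    (i : Fin 4) : ‖Thop N η x r i‖ ≤ x / 2 := by
  obtain ⟨M, G, hM, hG, -, hT⟩ := exists_Thop_eq hη x r i
  have hL := (monomialLE_linkOp N η r zero_le_one hM.monomial).norm_le zero_le_one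
  rw [hT, norm_smul, norm_hopping_coeff hx]
  calc x / 4 * ‖linkOp N η r M * G‖ ≤ x / 4 * (1 * 2) := by
        gcongr
        exact norm_mul_le_of_le hL hG
    _ = x / 2 := by ring

theorem norm_commutator_le {R : Type*} [NonUnitalSeminormedRing R] {a b : R} {c d : ℝ}
    (ha : ‖a‖ ≤ c) (hb : ‖b‖ ≤ d) : ‖a * b - b * a‖ ≤ 2 * c * d := by
  have h := norm_sub_le_of_le (norm_mul_le_of_le ha hb) (norm_mul_le_of_le hb ha)
  linarith

theorem norm_DE_commutator_Thop_le {N η : ℕ} (hη : 1 ≤ η) {x : ℝ} (hx : 0 < x)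
    (r : Fin (N - 1)) (i : Fin 4) :
    ‖DE N η r * Thop N η x r i - Thop N η x r i * DE N η r‖ ≤ x * (2 ^ (η - 1) : ℕ) := by
  obtain ⟨M, G, hM, hG, hDG, hT⟩ := exists_Thop_eq hη x r i
  have hL := (monomialLE_linkOp N η r (by positivity) hM.monomialLE_commutator).norm_le
    (by positivity)
  rw [← DE_commutator_linkOp] at hL
  have hcomm : DE N η r * Thop N η x r i - Thop N η x r i * DE N η r =
      ((x : ℂ) / 4) •
        ((DE N η r * linkOp N η r M - linkOp N η r M * DE N η r) * G) := by
    rw [hT, mul_smul_comm, smul_mul_assoc, ← smul_sub, sub_mul, mul_assoc _ G, ← hDG.eq,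
      mul_assoc, mul_assoc]
  rw [hcomm, norm_smul, norm_hopping_coeff hx]
  calc _ ≤ x / 4 * (2 * (2 ^ (η - 1) : ℕ) * 2) := by
        gcongr
        exact norm_mul_le_of_le hL hG
    _ = x * (2 ^ (η - 1) : ℕ) := by ring

theorem norm_Dlink_commutator_Thop_le {N η : ℕ} (hη : 1 ≤ η) {x μ : ℝ} (hx : 0 < x)
    (hμ : 0 ≤ μ) (r : Fin (N - 1)) (i : Fin 4) :
    ‖Dlink N η μ r * Thop N η x r i - Thop N η x r i * Dlink N η μ r‖ ≤
      x * (μ / 2 + (2 ^ (η - 1) : ℕ)) := by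
  have hM := norm_commutator_le (norm_DM_le N η hμ (siteL r)) (norm_Thop_le hη hx r i)
  have hE := norm_DE_commutator_Thop_le hη hx r i
  rw [Dlink, add_mul, mul_add, add_sub_add_comm]
  exact (norm_add_le_of_le hM hE).trans_eq (by ring)

theorem norm_double_commutator_le {N η : ℕ} (hη : 1 ≤ η) {x μ : ℝ} (hx : 0 < x)
    (hμ : 0 ≤ μ) (r s : Fin (N - 1)) (i j : Fin 4) :
    specNorm ((Dlink N η μ r * Thop N η x r i - Thop N η x r i * Dlink N η μ r) * Thop N η x s j
        - Thop N η x s j * (Dlink N η μ r * Thop N η x r i - Thop N η x r i * Dlink N η μ r)) ≤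
      x ^ 2 * (μ / 2 + (2 ^ (η - 1) : ℕ)) := by
  rw [specNorm_eq_norm]
  exact (norm_commutator_le (norm_Dlink_commutator_Thop_le hη hx hμ r i)
    (norm_Thop_le hη hx s j)).trans_eq (by ring)

end

/-- For all links `r, s` (the paper's `1 ≤ r, s ≤ N-1`) and all
`i, j ∈ {1,2,3,4}`, `‖[[D_r, T_r^(i)], T_s^(j)]‖ ≤ x² (μ/2 + Λ + 1/2)`, `Λ = 2^(η-1)`. -/
theorem double_commutator_D_T_T_bound
    (N η : ℕ) (hN : 2 ≤ N) (hNeven : Even N) (hη : 1 ≤ η) (x μ : ℝ) (hx : 0 < x) (hμ : 0 ≤ μ)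
    (r s : Fin (N - 1)) (i j : Fin 4) :
    specNorm ((Dlink N η μ r * Thop N η x r i - Thop N η x r i * Dlink N η μ r) * Thop N η x s j
        - Thop N η x s j * (Dlink N η μ r * Thop N η x r i - Thop N η x r i * Dlink N η μ r)) ≤
      x ^ 2 * (μ / 2 + ((2 ^ (η - 1) : ℕ) : ℝ) + 1 / 2) := by
  refine (norm_double_commutator_le hη hx hμ r s i j).trans ?_
  nlinarith [sq_nonneg x]
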